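/- arXiv:2605.13367 — 4 statements merged into one kernel-verified Lean document; each statement's English description precedes it below -/
import Mathlib

section
/- (Soundness of the rewriting.) Let T be a stratified ELI⊥⪯-TBox, A(a) an instance query, and 𝔄_A the nested NFA constructed for A from T (Definitions 3–4 of the paper). Then for all ABoxes A: if A ⊨ ∃x 𝔄_A(a,x), then (A,T) ⊨ A(a). -/
set_option autoImplicit false

/-! Core definitions for the description logic ELI-bot with stratification. -/

/-- Roles: role names and their inverses. -/
inductive DLRole (ρ : Type) : Type
  | pos (r : ρ)
  | inv (r : ρ)

/-- The inverse of a (possibly inverted) role. -/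
def DLRole.flip {ρ : Type} : DLRole ρ → DLRole ρ
  | .pos r => .inv r
  | .inv r => .pos r

/-- ELI-bot concepts over concept names `γ` and role names `ρ`. -/
inductive DLConcept (γ ρ : Type) : Type
  | bot
  | top
  | name (A : γ)
  | conj (C D : DLConcept γ ρ)
  | ex (s : DLRole ρ) (C : DLConcept γ ρ)

/-- Assertions: concept assertions `C(a)` and role assertions `s(a,b)`. -/
inductive DLAssertion (γ ρ ι : Type) : Type
  | conc (C : DLConcept γ ρ) (a : ι)
  | role (s : DLRole ρ) (a b : ι)

/-- A general concept inclusion `lhs ⊑ rhs`. -/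
structure DLGCI (γ ρ : Type) where
  lhs : DLConcept γ ρ
  rhs : DLConcept γ ρ

/-- Interpretations. -/
structure DLInterp (γ ρ ι : Type) where
  Dom : Type
  inh : Nonempty Dom
  iInd : ι → Dom
  iC : γ → Set Dom
  iR : ρ → Set (Dom × Dom)

variable {γ ρ ι : Type}

def DLInterp.role (I : DLInterp γ ρ ι) : DLRole ρ → Set (I.Dom × I.Dom)
  | .pos r => I.iR r
  | .inv r => {p | (p.2, p.1) ∈ I.iR r}

def DLInterp.conc (I : DLInterp γ ρ ι) : DLConcept γ ρ → Set I.Dom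
  | .bot => ∅
  | .top => Set.univ
  | .name A => I.iC A
  | .conj C D => I.conc C ∩ I.conc D
  | .ex s C => {d | ∃ e, (d, e) ∈ I.role s ∧ e ∈ I.conc C}

def DLInterp.satA (I : DLInterp γ ρ ι) : DLAssertion γ ρ ι → Prop
  | .conc C a => I.iInd a ∈ I.conc C
  | .role s a b => (I.iInd a, I.iInd b) ∈ I.role s

def DLInterp.satG (I : DLInterp γ ρ ι) (g : DLGCI γ ρ) : Prop :=
  I.conc g.lhs ⊆ I.conc g.rhs

/-- `I` is a model of the KB `(AB, T)`. -/
def DLModels (I : DLInterp γ ρ ι) (AB : Set (DLAssertion γ ρ ι))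
    (T : Set (DLGCI γ ρ)) : Prop :=
  (∀ α ∈ AB, I.satA α) ∧ (∀ g ∈ T, I.satG g)

/-- Entailment: every model of `(AB, T)` satisfies `α`. -/
def DLEntails (AB : Set (DLAssertion γ ρ ι)) (T : Set (DLGCI γ ρ))
    (α : DLAssertion γ ρ ι) : Prop :=
  ∀ I : DLInterp γ ρ ι, DLModels I AB T → I.satA α

/-- Atomic concepts: concept names, `⊤` and `⊥`. -/
def DLConcept.Atomic : DLConcept γ ρ → Prop
  | .bot => True
  | .top => True
  | .name _ => True
  | .conj _ _ => False
  | .ex _ _ => False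

/-- Concept names or `⊤` (no `⊥`). -/
def DLConcept.AtomNB : DLConcept γ ρ → Prop
  | .bot => False
  | .top => True
  | .name _ => True
  | .conj _ _ => False
  | .ex _ _ => False

/-- Normal form of GCIs: `A ⊑ B`, `A ⊓ B ⊑ C`, `A ⊑ ∃s.B`, `∃s.A ⊑ B`. -/
def DLGCI.Normal (g : DLGCI γ ρ) : Prop :=
  (g.lhs.Atomic ∧ g.rhs.Atomic) ∨
  ((∃ A B : γ, g.lhs = .conj (.name A) (.name B)) ∧ g.rhs.Atomic) ∨
  (g.lhs.Atomic ∧ ∃ (s : DLRole ρ) (B : DLConcept γ ρ), g.rhs = .ex s B ∧ B.AtomNB) ∨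
  ((∃ (s : DLRole ρ) (A : DLConcept γ ρ), g.lhs = .ex s A ∧ A.AtomNB) ∧ g.rhs.Atomic)

def NormalTBox (T : Set (DLGCI γ ρ)) : Prop := ∀ g ∈ T, g.Normal

/-- Symbols: concept names and (possibly inverted) roles, the carriers of the preorder. -/
inductive DLSym (γ ρ : Type) : Type
  | c (A : γ)
  | r (s : DLRole ρ)

/-- Strict part of a preorder. -/
def StrictOf (le : DLSym γ ρ → DLSym γ ρ → Prop) (x y : DLSym γ ρ) : Prop :=
  le x y ∧ ¬ le y x

/-- `le` witnesses that the normal-form TBox `T` is stratified. -/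
def StratifiedWith (T : Set (DLGCI γ ρ)) (le : DLSym γ ρ → DLSym γ ρ → Prop) : Prop :=
  Reflexive le ∧ Transitive le ∧
  (∀ A B : γ, (⟨.name A, .name B⟩ : DLGCI γ ρ) ∈ T → le (.c A) (.c B)) ∧
  (∀ A B C : γ, (⟨.conj (.name A) (.name B), .name C⟩ : DLGCI γ ρ) ∈ T →
      le (.c A) (.c C) ∧ le (.c B) (.c C) ∧
        (StrictOf le (.c A) (.c C) ∨ StrictOf le (.c B) (.c C))) ∧
  (∀ (A : γ) (s : DLRole ρ) (D : DLConcept γ ρ),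
      (⟨.name A, .ex s D⟩ : DLGCI γ ρ) ∈ T →
        (∀ Dn : γ, D = .name Dn → le (.c A) (.c Dn)) ∧ le (.c A) (.r s)) ∧
  (∀ (B : γ) (s : DLRole ρ) (D : DLConcept γ ρ),
      (⟨.ex s D, .name B⟩ : DLGCI γ ρ) ∈ T →
        ∀ Dn : γ, D = .name Dn →
          (StrictOf le (.c Dn) (.c B) ∨ Dn = B) ∧ le (.r s) (.c Dn)) ∧
  (∀ r : ρ, le (.r (.pos r)) (.r (.inv r)) ∧ le (.r (.inv r)) (.r (.pos r)))

/-- There is a chain `α₀ ≺ α₁ ≺ ⋯ ≺ α_k = α` (with `k` strict steps). -/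
def ChainTo (le : DLSym γ ρ → DLSym γ ρ → Prop) (k : ℕ) (α : DLSym γ ρ) : Prop :=
  ∃ f : ℕ → DLSym γ ρ, f k = α ∧ ∀ i < k, StrictOf le (f i) (f (i + 1))

/-- The height of a symbol: length of the longest strict chain ending in it. -/
def SymHeight (le : DLSym γ ρ → DLSym γ ρ → Prop) (α : DLSym γ ρ) (n : ℕ) : Prop :=
  ChainTo le n α ∧ ∀ m, ChainTo le m α → m ≤ n

/-- Height of a concept: `⊤, ⊥` have height 0, otherwise max over the symbols occurring. -/
inductive ConcHeight (le : DLSym γ ρ → DLSym γ ρ → Prop) : DLConcept γ ρ → ℕ → Prop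
  | top : ConcHeight le .top 0
  | bot : ConcHeight le .bot 0
  | name {A : γ} {n : ℕ} : SymHeight le (.c A) n → ConcHeight le (.name A) n
  | conj {C D : DLConcept γ ρ} {m k : ℕ} :
      ConcHeight le C m → ConcHeight le D k → ConcHeight le (.conj C D) (max m k)
  | ex {s : DLRole ρ} {C : DLConcept γ ρ} {m k : ℕ} :
      SymHeight le (.r s) m → ConcHeight le C k → ConcHeight le (.ex s C) (max m k)

def ConcHeightLe (le : DLSym γ ρ → DLSym γ ρ → Prop) (C : DLConcept γ ρ) (n : ℕ) : Prop :=
  ∃ m ≤ n, ConcHeight le C m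

/-- `T↾n`: the GCIs of `T` that solely involve concepts of height at most `n`. -/
def TRestrict (T : Set (DLGCI γ ρ)) (le : DLSym γ ρ → DLSym γ ρ → Prop) (n : ℕ) :
    Set (DLGCI γ ρ) :=
  {g ∈ T | ConcHeightLe le g.lhs n ∧ ConcHeightLe le g.rhs n}

/-- Subconcepts. -/
def DLConcept.sub : DLConcept γ ρ → Set (DLConcept γ ρ)
  | .bot => {DLConcept.bot}
  | .top => {DLConcept.top}
  | .name A => {DLConcept.name A}
  | .conj C D => insert (DLConcept.conj C D) (C.sub ∪ D.sub)
  | .ex s C => insert (DLConcept.ex s C) C.sub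

/-- `con(T)`: atomic concepts occurring in `T`, together with `⊤` and `⊥`. -/
def ConOf (T : Set (DLGCI γ ρ)) : Set (DLConcept γ ρ) :=
  {C | C = .top ∨ C = .bot ∨
    (C.Atomic ∧ ∃ g ∈ T, C ∈ g.lhs.sub ∪ g.rhs.sub)}

/-- Individual names occurring in an ABox. -/
def indsOf (AB : Set (DLAssertion γ ρ ι)) : Set ι :=
  {a | (∃ C, DLAssertion.conc C a ∈ AB) ∨ (∃ s b, DLAssertion.role s a b ∈ AB) ∨
    (∃ s b, DLAssertion.role s b a ∈ AB)}

/-- A (possibly inverted) role edge recorded in the ABox. -/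
def roleIn (AB : Set (DLAssertion γ ρ ι)) (s : DLRole ρ) (a b : ι) : Prop :=
  DLAssertion.role s a b ∈ AB ∨ DLAssertion.role s.flip b a ∈ AB

/-- `C(a)` holds in the ABox; `⊤(a)` abbreviates that `a` occurs in the ABox. -/
def concIn (AB : Set (DLAssertion γ ρ ι)) (C : DLConcept γ ρ) (a : ι) : Prop :=
  DLAssertion.conc C a ∈ AB ∨ (C = DLConcept.top ∧ a ∈ indsOf AB)

/-- ABoxes are finite and only assert atomic concepts. -/
def IsABox (AB : Set (DLAssertion γ ρ ι)) : Prop :=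
  AB.Finite ∧ ∀ (C : DLConcept γ ρ) (a : ι), DLAssertion.conc C a ∈ AB → C.Atomic

/-- The interpretation given by an ABox (viewed as a graph database). -/
def abInterp [Nonempty ι] (AB : Set (DLAssertion γ ρ ι)) : DLInterp γ ρ ι where
  Dom := ι
  inh := inferInstance
  iInd := id
  iC := fun A => {a | DLAssertion.conc (DLConcept.name A) a ∈ AB}
  iR := fun r => {p | roleIn AB (DLRole.pos r) p.1 p.2}

/-! ### The constructed nested automata `𝔄_A` (Definitions 3 and 4 of the paper) -/

/-- States of the constructed automata: a premise (set of concepts) and a goal. -/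
abbrev AState (γ ρ : Type) := Set (DLConcept γ ρ) × DLConcept γ ρ

/-- Letters of the constructed automata: roles, concept tests and automaton tests. -/
inductive ALetter (γ ρ : Type) : Type
  | role (s : DLRole ρ)
  | ctest (C : DLConcept γ ρ)
  | atest (B : γ)

def initState (A : γ) : AState γ ρ := ({DLConcept.top}, DLConcept.name A)

def finalA (q : AState γ ρ) : Prop := q.2 ∈ q.1 ∨ DLConcept.bot ∈ q.1

/-- The transition relation of the automaton `𝔄_A` at nesting level `n`
(Definitions 3 and 4 of the paper). -/
inductive ATrans (T : Set (DLGCI γ ρ)) (le : DLSym γ ρ → DLSym γ ρ → Prop) (n : ℕ) :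
    AState γ ρ → ALetter γ ρ → AState γ ρ → Prop
  | weak {p : Set (DLConcept γ ρ)} {g : DLConcept γ ρ} (p' : Set (DLConcept γ ρ)) :
      p' ⊆ p →
      ATrans T le n (p, g) (.ctest .top) (insert DLConcept.top p', g)
  | data {p : Set (DLConcept γ ρ)} {g : DLConcept γ ρ} (B : γ) :
      DLConcept.name B ∈ ConOf (TRestrict T le n) →
      ATrans T le n (p, g) (.ctest (.name B)) (insert (DLConcept.name B) p, g)
  | sbus {p : Set (DLConcept γ ρ)} {C D : DLConcept γ ρ} :
      (⟨C, D⟩ : DLGCI γ ρ) ∈ TRestrict T le n → C.Atomic → D.Atomic →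
      ATrans T le n (p, D) (.ctest .top) (p, C)
  | succ {p : Set (DLConcept γ ρ)} {s : DLRole ρ} {C D : DLConcept γ ρ} :
      (⟨.ex s C, D⟩ : DLGCI γ ρ) ∈ TRestrict T le n →
      ATrans T le n (p, D) (.role s) ({DLConcept.top}, C)
  | anon {p : Set (DLConcept γ ρ)} {B D : DLConcept γ ρ} :
      B ∈ ConOf (TRestrict T le n) → D ∈ ConOf (TRestrict T le n) →
      DLEntails ((fun C => DLAssertion.conc C ()) '' insert B p) (TRestrict T le n)
        (DLAssertion.conc D ()) →
      ATrans T le n (p, D) (.ctest .top) (p, B)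
  | nocl {p : Set (DLConcept γ ρ)} {B C D : γ} : 0 < n →
      (⟨.conj (.name B) (.name C), .name D⟩ : DLGCI γ ρ) ∈ TRestrict T le n →
      DLConcept.name B ∈ p →
      ATrans T le n (p, .name D) (.ctest .top) (p, .name C)
  | nocr {p : Set (DLConcept γ ρ)} {B C D : γ} : 0 < n →
      (⟨.conj (.name C) (.name B), .name D⟩ : DLGCI γ ρ) ∈ TRestrict T le n →
      DLConcept.name B ∈ p →
      ATrans T le n (p, .name D) (.ctest .top) (p, .name C)
  | aut {p : Set (DLConcept γ ρ)} {g : DLConcept γ ρ} (B : γ) : 0 < n →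
      DLConcept.name B ∈ ConOf (TRestrict T le (n - 1)) →
      (∃ m < n, SymHeight le (.c B) m) →
      ATrans T le n (p, g) (.atest B) (insert (DLConcept.name B) p, g)

/-- Reachability by runs of the constructed automata over an interpretation `I`:
`AReach T le I n q d q' d'` holds if the level-`n` automaton can go from state `q`
at element `d` to state `q'` at element `d'`.  An automaton test `𝔄_B?` requires an
accepting run of the automaton for `B` (at the level given by the height of `B`). -/
inductive AReach (T : Set (DLGCI γ ρ)) (le : DLSym γ ρ → DLSym γ ρ → Prop)
    (I : DLInterp γ ρ ι) : ℕ → AState γ ρ → I.Dom → AState γ ρ → I.Dom → Prop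
  | refl (n : ℕ) (q : AState γ ρ) (d : I.Dom) : AReach T le I n q d q d
  | role {n : ℕ} {q : AState γ ρ} {d : I.Dom} {q' : AState γ ρ} {d' : I.Dom}
      {q'' : AState γ ρ} {d'' : I.Dom} {s : DLRole ρ} :
      AReach T le I n q d q' d' → ATrans T le n q' (.role s) q'' →
      (d', d'') ∈ I.role s → AReach T le I n q d q'' d''
  | ctest {n : ℕ} {q : AState γ ρ} {d : I.Dom} {q' : AState γ ρ} {d' : I.Dom}
      {q'' : AState γ ρ} {C : DLConcept γ ρ} :
      AReach T le I n q d q' d' → ATrans T le n q' (.ctest C) q'' →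
      d' ∈ I.conc C → AReach T le I n q d q'' d'
  | atest {n : ℕ} {q : AState γ ρ} {d : I.Dom} {q' : AState γ ρ} {d' : I.Dom}
      {q'' : AState γ ρ} {B : γ} {m : ℕ} {p : AState γ ρ} {e : I.Dom} :
      AReach T le I n q d q' d' → ATrans T le n q' (.atest B) q'' →
      SymHeight le (.c B) m →
      AReach T le I m (initState B) d' p e → finalA p →
      AReach T le I n q d q'' d'

/-- There is an accepting run of the level-`n` automaton `𝔄_A` starting from `d`. -/
def AAccept (T : Set (DLGCI γ ρ)) (le : DLSym γ ρ → DLSym γ ρ → Prop)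
    (I : DLInterp γ ρ ι) (n : ℕ) (A : γ) (d : I.Dom) : Prop :=
  ∃ q e, AReach T le I n (initState A) d q e ∧ finalA q

/-- An explicit run `ρ₁ ⋯ ρ_ℓ` of the level-`n` automaton over `I`, given by its
elements `d i`, states `q i` and letters `w i`. -/
structure ARun (T : Set (DLGCI γ ρ)) (le : DLSym γ ρ → DLSym γ ρ → Prop)
    (I : DLInterp γ ρ ι) (n ℓ : ℕ) where
  d : ℕ → I.Dom
  q : ℕ → AState γ ρ
  w : ℕ → ALetter γ ρ
  htrans : ∀ i < ℓ, ATrans T le n (q i) (w i) (q (i + 1))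
  hrole : ∀ i < ℓ, ∀ s : DLRole ρ, w i = .role s → (d i, d (i + 1)) ∈ I.role s
  hctest : ∀ i < ℓ, ∀ C : DLConcept γ ρ, w i = .ctest C →
      d i = d (i + 1) ∧ d i ∈ I.conc C
  hatest : ∀ i < ℓ, ∀ B : γ, w i = .atest B → d i = d (i + 1) ∧
      ∃ m, SymHeight le (.c B) m ∧ AAccept T le I m B (d i)

/-! ### Generic nested two-way regular path automata (n-nested NFAs) -/

/-- Letters of a generic nested automaton: roles, concept tests, and tests referring
to the `j`-th automaton of a system. -/
inductive GLetter (γ ρ : Type) : Type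
  | role (s : DLRole ρ)
  | ctest (C : DLConcept γ ρ)
  | atest (j : ℕ)

/-- A system of nested automata with state space `Q`: automaton `k` is `k`-nested,
i.e. its automaton tests only refer to automata of strictly smaller index, and all
concept tests are over atomic concepts. -/
structure AutoSys (γ ρ : Type) (Q : Type) where
  δ : ℕ → Q → GLetter γ ρ → Q → Prop
  init : ℕ → Q
  final : ℕ → Q → Prop
  nested : ∀ k q j q', δ k q (.atest j) q' → j < k
  testsAtomic : ∀ k q (C : DLConcept γ ρ) q', δ k q (.ctest C) q' → C.Atomic

/-- Reachability by runs of the automata of a system over an interpretation. -/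
inductive GReach {Q : Type} (S : AutoSys γ ρ Q) (I : DLInterp γ ρ ι) :
    ℕ → Q → I.Dom → Q → I.Dom → Prop
  | refl (k : ℕ) (q : Q) (d : I.Dom) : GReach S I k q d q d
  | role {k : ℕ} {q : Q} {d : I.Dom} {q' : Q} {d' : I.Dom} {q'' : Q} {d'' : I.Dom}
      {s : DLRole ρ} :
      GReach S I k q d q' d' → S.δ k q' (.role s) q'' → (d', d'') ∈ I.role s →
      GReach S I k q d q'' d''
  | ctest {k : ℕ} {q : Q} {d : I.Dom} {q' : Q} {d' : I.Dom} {q'' : Q}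
      {C : DLConcept γ ρ} :
      GReach S I k q d q' d' → S.δ k q' (.ctest C) q'' → d' ∈ I.conc C →
      GReach S I k q d q'' d'
  | atest {k : ℕ} {q : Q} {d : I.Dom} {q' : Q} {d' : I.Dom} {q'' : Q} {j : ℕ}
      {p : Q} {e : I.Dom} :
      GReach S I k q d q' d' → S.δ k q' (.atest j) q'' →
      GReach S I j (S.init j) d' p e → S.final j p →
      GReach S I k q d q'' d'

/-- Acceptance for the `k`-th automaton of a system, starting from `d`. -/
def GAccept {Q : Type} (S : AutoSys γ ρ Q) (I : DLInterp γ ρ ι) (k : ℕ)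
    (d : I.Dom) : Prop :=
  ∃ q e, GReach S I k (S.init k) d q e ∧ S.final k q

/-! ### Derivations (Definition 5 of the paper) -/

/-- A derivation step `AB ⇝_T AB'` applying a GCI (`none` for the `⊥`-rule), recording
the GCI used, the premise assertion `used` and the newly added assertion `added`. -/
inductive DStep (T : Set (DLGCI γ ρ)) (tgt : DLAssertion γ ρ ι) :
    Option (DLGCI γ ρ) → DLAssertion γ ρ ι → DLAssertion γ ρ ι →
    Set (DLAssertion γ ρ ι) → Set (DLAssertion γ ρ ι) → Prop
  | sub {AB : Set (DLAssertion γ ρ ι)} {B C : DLConcept γ ρ} {b : ι} :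
      (⟨B, C⟩ : DLGCI γ ρ) ∈ T → B.AtomNB → C.AtomNB → concIn AB B b →
      DStep T tgt (some ⟨B, C⟩) (.conc B b) (.conc C b) AB (insert (.conc C b) AB)
  | conj₁ {AB : Set (DLAssertion γ ρ ι)} {B₁ B₂ C : DLConcept γ ρ} {b : ι} :
      (⟨.conj B₁ B₂, C⟩ : DLGCI γ ρ) ∈ T → concIn AB B₁ b → concIn AB B₂ b →
      DStep T tgt (some ⟨.conj B₁ B₂, C⟩) (.conc B₁ b) (.conc C b) AB
        (insert (.conc C b) AB)
  | conj₂ {AB : Set (DLAssertion γ ρ ι)} {B₁ B₂ C : DLConcept γ ρ} {b : ι} :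
      (⟨.conj B₁ B₂, C⟩ : DLGCI γ ρ) ∈ T → concIn AB B₁ b → concIn AB B₂ b →
      DStep T tgt (some ⟨.conj B₁ B₂, C⟩) (.conc B₂ b) (.conc C b) AB
        (insert (.conc C b) AB)
  | exR {AB : Set (DLAssertion γ ρ ι)} {B : DLConcept γ ρ} {s : DLRole ρ}
      {C₁ : DLConcept γ ρ} {b c : ι} :
      (⟨B, .ex s C₁⟩ : DLGCI γ ρ) ∈ T → B.AtomNB → concIn AB B b → c ∉ indsOf AB →
      DStep T tgt (some ⟨B, .ex s C₁⟩) (.conc B b) (.conc C₁ c) AB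
        (insert (.role s b c) (insert (.conc C₁ c) AB))
  | exL {AB : Set (DLAssertion γ ρ ι)} {B₁ : DLConcept γ ρ} {s : DLRole ρ}
      {C : DLConcept γ ρ} {b c : ι} :
      (⟨.ex s B₁, C⟩ : DLGCI γ ρ) ∈ T → roleIn AB s b c → concIn AB B₁ c →
      DStep T tgt (some ⟨.ex s B₁, C⟩) (.conc B₁ c) (.conc C b) AB
        (insert (.conc C b) AB)
  | bot {AB : Set (DLAssertion γ ρ ι)} {b : ι} :
      DLAssertion.conc DLConcept.bot b ∈ AB →
      DStep T tgt none (.conc .bot b) tgt AB {tgt}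

/-- `seq 0, …, seq n` is a `T`-derivation of `tgt` from the ABox `AB`. -/
def IsDeriv (T : Set (DLGCI γ ρ)) (tgt : DLAssertion γ ρ ι)
    (AB : Set (DLAssertion γ ρ ι)) (seq : ℕ → Set (DLAssertion γ ρ ι)) (n : ℕ) : Prop :=
  seq 0 ⊆ AB ∧ tgt ∈ seq n ∧
    ∀ i < n, ∃ og u ad, DStep T tgt og u ad (seq i) (seq (i + 1))

/-- `tgt` is `T`-derivable from `AB`. -/
def Derivable (T : Set (DLGCI γ ρ)) (tgt : DLAssertion γ ρ ι)
    (AB : Set (DLAssertion γ ρ ι)) : Prop :=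
  ∃ n seq, IsDeriv T tgt AB seq n

/-- A `(T, ℓ)`-derivation from `AB` of length `n`: a sequence of ABoxes `Ab i`
paired with active instance queries `(qc i)(qa i)` (concepts of `T↾ℓ` of height at
most `ℓ`), every prefix being a `T↾ℓ`-derivation of the corresponding active query,
with recorded step information and the stratification condition on steps applying a
GCI whose right-hand side has height `ℓ`. -/
structure StratDeriv (T : Set (DLGCI γ ρ)) (le : DLSym γ ρ → DLSym γ ρ → Prop)
    (ℓ : ℕ) (AB : Set (DLAssertion γ ρ ι)) (n : ℕ) where
  Ab : ℕ → Set (DLAssertion γ ρ ι)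
  qc : ℕ → DLConcept γ ρ
  qa : ℕ → ι
  og : ℕ → Option (DLGCI γ ρ)
  used : ℕ → DLAssertion γ ρ ι
  added : ℕ → DLAssertion γ ρ ι
  hstart : Ab 0 ⊆ AB
  hactive : ∀ i ≤ n, qc i ∈ ConOf (TRestrict T le ℓ) ∧ ConcHeightLe le (qc i) ℓ
  hstep : ∀ i < n,
      DStep (TRestrict T le ℓ) (DLAssertion.conc (qc (i + 1)) (qa (i + 1)))
        (og i) (used i) (added i) (Ab i) (Ab (i + 1))
  hderiv : ∀ i ≤ n, concIn (Ab i) (qc i) (qa i) ∧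
      ∀ j < i, ∃ og' u' ad',
        DStep (TRestrict T le ℓ) (DLAssertion.conc (qc i) (qa i)) og' u' ad'
          (Ab j) (Ab (j + 1))
  hstrat : ∀ i < n, ∀ g : DLGCI γ ρ, og i = some g → ConcHeight le g.rhs ℓ →
      (∀ B' : γ, DLConcept.name B' ∈ g.lhs.sub → SymHeight le (.c B') ℓ →
        qc i = .name B') ∧
      (∀ B'' : γ, DLConcept.name B'' ∈ g.rhs.sub → qc (i + 1) = .name B'')

/-- The restriction of an ABox to concept assertions about `a` whose concepts have
height at most `m`. -/
def ARestrictAt (le : DLSym γ ρ → DLSym γ ρ → Prop) (AB : Set (DLAssertion γ ρ ι))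
    (a : ι) (m : ℕ) : Set (DLAssertion γ ρ ι) :=
  {α | ∃ C : DLConcept γ ρ, α = DLAssertion.conc C a ∧ α ∈ AB ∧ ConcHeightLe le C m}

/-- A map between interpretations that preserves concept names and role names. -/
structure DLInterp.IsHom {ι' : Type} (I : DLInterp γ ρ ι) (J : DLInterp γ ρ ι')
    (f : I.Dom → J.Dom) : Prop where
  conc : ∀ (A : γ) (d : I.Dom), d ∈ I.iC A → f d ∈ J.iC A
  role : ∀ (r : ρ) (d e : I.Dom), (d, e) ∈ I.iR r → (f d, f e) ∈ J.iR r

theorem DLInterp.IsHom.map_role {ι' : Type} {I : DLInterp γ ρ ι} {J : DLInterp γ ρ ι'}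
    {f : I.Dom → J.Dom} (hf : I.IsHom J f) {s : DLRole ρ} {d e : I.Dom}
    (h : (d, e) ∈ I.role s) : (f d, f e) ∈ J.role s := by
  cases s with
  | pos r => exact hf.role r d e h
  | inv r => exact hf.role r e d h

/-- The interpretation `J` with every individual of a new index type sent to `x`. -/
def DLInterp.pointed (J : DLInterp γ ρ ι) (κ : Type) (x : J.Dom) : DLInterp γ ρ κ where
  Dom := J.Dom
  inh := J.inh
  iInd := fun _ => x
  iC := J.iC
  iR := J.iR

theorem DLInterp.pointed_role (J : DLInterp γ ρ ι) (κ : Type) (x : J.Dom) (s : DLRole ρ) :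
    (J.pointed κ x).role s = J.role s := by
  cases s <;> rfl

theorem DLInterp.pointed_conc (J : DLInterp γ ρ ι) (κ : Type) (x : J.Dom)
    (C : DLConcept γ ρ) : (J.pointed κ x).conc C = J.conc C := by
  induction C with
  | bot => rfl
  | top => rfl
  | name A => rfl
  | conj C D ihC ihD => simp only [DLInterp.conc, ihC, ihD]; rfl
  | ex s C ih => simp only [DLInterp.conc, ih, DLInterp.pointed_role]; rfl

/-- Entailment from concept assertions about one individual, read off at any element of a
model of the TBox. -/
theorem DLEntails.mem_conc {κ : Type} {T : Set (DLGCI γ ρ)} {S : Set (DLConcept γ ρ)}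
    {D : DLConcept γ ρ} {k : κ}
    (h : DLEntails ((fun C => DLAssertion.conc C k) '' S) T (.conc D k))
    {J : DLInterp γ ρ ι} (hJ : ∀ g ∈ T, J.satG g) {x : J.Dom}
    (hx : ∀ C ∈ S, x ∈ J.conc C) : x ∈ J.conc D := by
  have hD : x ∈ (J.pointed κ x).conc D := by
    refine h (J.pointed κ x) ⟨?_, fun g hg => ?_⟩
    · rintro _ ⟨C, hC, rfl⟩
      change x ∈ (J.pointed κ x).conc C
      rw [DLInterp.pointed_conc]
      exact hx C hC
    · change (J.pointed κ x).conc g.lhs ⊆ (J.pointed κ x).conc g.rhs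
      rw [DLInterp.pointed_conc, DLInterp.pointed_conc]
      exact hJ g hg
  rwa [DLInterp.pointed_conc] at hD

/-- `x` satisfies every concept of the premise of the state `q`. -/
def DLInterp.SatPremise (J : DLInterp γ ρ ι) (q : AState γ ρ) (x : J.Dom) : Prop :=
  ∀ C ∈ q.1, x ∈ J.conc C

theorem DLInterp.satPremise_insert {J : DLInterp γ ρ ι} {p : Set (DLConcept γ ρ)}
    {g C : DLConcept γ ρ} {x : J.Dom} (hC : x ∈ J.conc C) (hp : ∀ D ∈ p, x ∈ J.conc D) :
    J.SatPremise (insert C p, g) x := by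
  rintro D (rfl | hD)
  exacts [hC, hp D hD]

theorem DLInterp.satPremise_initState (J : DLInterp γ ρ ι) (A : γ) (x : J.Dom) :
    J.SatPremise (initState A) x := by
  rintro C rfl
  exact Set.mem_univ x

theorem DLInterp.SatPremise.goal_of_finalA {J : DLInterp γ ρ ι} {q : AState γ ρ} {x : J.Dom}
    (h : J.SatPremise q x) (hq : finalA q) : x ∈ J.conc q.2 :=
  hq.elim (h _) fun hbot => (h _ hbot).elim

/-- Runs propagate the truth of premises forwards and the truth of goals backwards, in every
model of the TBox to which the interpretation maps homomorphically. -/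
theorem AReach.sound {ι' : Type} {T : Set (DLGCI γ ρ)} {le : DLSym γ ρ → DLSym γ ρ → Prop}
    {I : DLInterp γ ρ ι} {J : DLInterp γ ρ ι'} {f : I.Dom → J.Dom} (hf : I.IsHom J f)
    (hJ : ∀ g ∈ T, J.satG g) {n : ℕ} {q : AState γ ρ} {d : I.Dom} {q' : AState γ ρ}
    {d' : I.Dom} (h : AReach T le I n q d q' d') (hq : J.SatPremise q (f d)) :
    J.SatPremise q' (f d') ∧ (f d' ∈ J.conc q'.2 → f d ∈ J.conc q.2) := by
  induction h with
  | refl n q d => exact ⟨hq, id⟩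
  | role _ ht hr ih =>
    obtain ⟨-, hgoal⟩ := ih hq
    cases ht with
    | succ hT =>
      refine ⟨?_, fun hC => hgoal (hJ _ hT.1 ⟨_, hf.map_role hr, hC⟩)⟩
      rintro C rfl
      exact Set.mem_univ _
  | ctest _ ht hc ih =>
    obtain ⟨hprem, hgoal⟩ := ih hq
    cases ht with
    | weak p' hp' =>
      exact ⟨DLInterp.satPremise_insert (Set.mem_univ _) fun D hD => hprem D (hp' hD), hgoal⟩
    | data B hB => exact ⟨DLInterp.satPremise_insert (hf.conc _ _ hc) hprem, hgoal⟩
    | sbus hT _ _ => exact ⟨hprem, fun hC => hgoal (hJ _ hT.1 hC)⟩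
    | anon _ _ hent =>
      refine ⟨hprem, fun hB => hgoal (hent.mem_conc (fun g hg => hJ g hg.1) ?_)⟩
      rintro D (rfl | hD)
      exacts [hB, hprem D hD]
    | nocl _ hT hB => exact ⟨hprem, fun hC => hgoal (hJ _ hT.1 ⟨hprem _ hB, hC⟩)⟩
    | nocr _ hT hB => exact ⟨hprem, fun hC => hgoal (hJ _ hT.1 ⟨hC, hprem _ hB⟩)⟩
  | atest _ ht _ _ hfin ih ihB =>
    obtain ⟨hprem, hgoal⟩ := ih hq
    cases ht with
    | aut B _ _ _ =>
      obtain ⟨hpB, hgB⟩ := ihB (J.satPremise_initState _ _)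
      exact ⟨DLInterp.satPremise_insert (hgB (hpB.goal_of_finalA hfin)) hprem, hgoal⟩

/-- Every model of an ABox receives a homomorphism from the interpretation of the ABox. -/
theorem isHom_iInd [Nonempty ι] {AB : Set (DLAssertion γ ρ ι)} {J : DLInterp γ ρ ι}
    (hJ : ∀ α ∈ AB, J.satA α) : (abInterp AB).IsHom J J.iInd where
  conc _ _ h := hJ _ h
  role _ _ _ h := h.elim (fun h => hJ _ h) fun h => hJ _ h

/-- Lemma 5 of the paper, soundness of the rewriting.
If there is an accepting run of the nested NFA `𝔄_A` (of Definitions 3–4) from `a`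
in the interpretation given by the ABox, then `(AB, T) ⊨ A(a)`. -/
theorem stmt1
    (T : Set (DLGCI ℕ ℕ)) (le : DLSym ℕ ℕ → DLSym ℕ ℕ → Prop)
    (hfin : T.Finite) (hnf : NormalTBox T) (hstrat : StratifiedWith T le)
    (A : ℕ) (n : ℕ) (hheight : SymHeight le (DLSym.c A) n)
    (a : ℕ) (AB : Set (DLAssertion ℕ ℕ ℕ)) (hAB : IsABox AB) :
    AAccept T le (abInterp AB) n A a →
    DLEntails AB T (DLAssertion.conc (DLConcept.name A) a) := by
  rintro ⟨q, e, hreach, hfinal⟩ J hJ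
  obtain ⟨hprem, hgoal⟩ := hreach.sound (isHom_iInd hJ.1) hJ.2 (J.satPremise_initState A _)
  exact hgoal (hprem.goal_of_finalA hfinal)
end

section
/- Let φ = Q₁x₁⋯Q_nx_n ψ be a quantified Boolean formula with Q_i ∈ {∃,∀} and ψ = ⋁_{j=1}^m λ_{j1} ∧ λ_{j2} ∧ λ_{j3} in 3-DNF. Let A = {L₀(a)} and let T be the TBox of the reduction (described in the context). Then (A,T) ⊨ C₀^True(a) if and only if φ is valid. -/
set_option autoImplicit false

variable {γ ρ ι : Type}

/-! ### The QBF reduction -/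

/-- Concept names of the QBF reduction: `L i`, `X i b` (`b = true` for `X_i^1`),
`C_i^True` (`CT i`), `C_i^{True,b}` (`CTb i b`), `A_j^1` (`A1 j`), `A_j^2` (`A2 j`). -/
inductive CN : Type
  | L (i : ℕ)
  | X (i : ℕ) (b : Bool)
  | CT (i : ℕ)
  | CTb (i : ℕ) (b : Bool)
  | A1 (j : ℕ)
  | A2 (j : ℕ)

/-- Role names of the QBF reduction: `r d i` is `r_{d,i}` (direction `d`, level `i`). -/
inductive RN : Type
  | r (d : Bool) (i : ℕ)

/-- Satisfaction of the 3-DNF matrix `ψ = ⋁_{j=1}^m λ_{j1} ∧ λ_{j2} ∧ λ_{j3}`,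
where the literal `λ_{jk}` is `x_i` if `lit j k = (i, true)` and `¬x_i` if
`lit j k = (i, false)`. -/
def SatPsi (m : ℕ) (lit : ℕ → ℕ → ℕ × Bool) (v : ℕ → Bool) : Prop :=
  ∃ j, 1 ≤ j ∧ j ≤ m ∧ ∀ k, 1 ≤ k → k ≤ 3 → v (lit j k).1 = (lit j k).2

/-- `QVal Qf Sat k i v`: validity of `Q_i x_i ⋯ Q_{i+k-1} x_{i+k-1}. Sat` under the
partial assignment `v`, where `Qf i = true` means `Q_i = ∀` and
`Qf i = false` means `Q_i = ∃`. -/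
def QVal (Qf : ℕ → Bool) (Sat : (ℕ → Bool) → Prop) : ℕ → ℕ → (ℕ → Bool) → Prop
  | 0, _, v => Sat v
  | k + 1, i, v =>
      if Qf i = true then ∀ b, QVal Qf Sat k (i + 1) (Function.update v i b)
      else ∃ b, QVal Qf Sat k (i + 1) (Function.update v i b)

/-- The TBox of the QBF reduction (for the prenex 3-DNF QBF given by `n`, `m`,
`Qf` and `lit`). -/
def Tqbf (n m : ℕ) (Qf : ℕ → Bool) (lit : ℕ → ℕ → ℕ × Bool) : Set (DLGCI CN RN) :=
  {g |
    -- L_i ⊑ ∃r_{d,i+1}.L_{i+1}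
    (∃ i < n, ∃ d : Bool,
      g = ⟨.name (.L i), .ex (.pos (.r d (i + 1))) (.name (.L (i + 1)))⟩) ∨
    -- ∃r̄_{d,i+1}.L_i ⊑ X_{i+1}^d
    (∃ i < n, ∃ d : Bool,
      g = ⟨.ex (.inv (.r d (i + 1))) (.name (.L i)), .name (.X (i + 1) d)⟩) ∨
    -- ∃r̄_{d,k}.X_i^b ⊑ X_i^b  (propagating assignments down the tree)
    (∃ i, 1 ≤ i ∧ i ≤ n ∧ ∃ b : Bool, ∃ d : Bool, ∃ k, 1 ≤ k ∧ k ≤ n ∧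
      g = ⟨.ex (.inv (.r d k)) (.name (.X i b)), .name (.X i b)⟩) ∨
    -- L_n ⊓ X_{i}^{pol} ⊑ A_j^1 for λ_{j1}
    (∃ j, 1 ≤ j ∧ j ≤ m ∧
      g = ⟨.conj (.name (.L n)) (.name (.X (lit j 1).1 (lit j 1).2)),
            .name (.A1 j)⟩) ∨
    -- A_j^1 ⊓ X_{i}^{pol} ⊑ A_j^2 for λ_{j2}
    (∃ j, 1 ≤ j ∧ j ≤ m ∧
      g = ⟨.conj (.name (.A1 j)) (.name (.X (lit j 2).1 (lit j 2).2)),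
            .name (.A2 j)⟩) ∨
    -- A_j^2 ⊓ X_{i}^{pol} ⊑ C_n^True for λ_{j3}
    (∃ j, 1 ≤ j ∧ j ≤ m ∧
      g = ⟨.conj (.name (.A2 j)) (.name (.X (lit j 3).1 (lit j 3).2)),
            .name (.CT n)⟩) ∨
    -- ∃r_{d,i+1}.C_{i+1}^True ⊑ C_i^{True,d}
    (∃ i < n, ∃ d : Bool,
      g = ⟨.ex (.pos (.r d (i + 1))) (.name (.CT (i + 1))), .name (.CTb i d)⟩) ∨
    -- C_i^{True,d} ⊑ C_i^True when Q_{i+1} = ∃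
    (∃ i < n, Qf (i + 1) = false ∧ ∃ d : Bool,
      g = ⟨.name (.CTb i d), .name (.CT i)⟩) ∨
    -- C_i^{True,0} ⊓ C_i^{True,1} ⊑ C_i^True when Q_{i+1} = ∀
    (∃ i < n, Qf (i + 1) = true ∧
      g = ⟨.conj (.name (.CTb i false)) (.name (.CTb i true)), .name (.CT i)⟩)}

/-- In a model of `Tqbf`, a node of level `n - k` whose concepts record the assignment `v`
satisfies `C_{n-k}^True` as soon as the remaining formula is valid under `v`. -/
theorem mem_CT_of_QVal {n m : ℕ} {Qf : ℕ → Bool} {lit : ℕ → ℕ → ℕ × Bool}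
    (hlit : ∀ j k, 1 ≤ j → j ≤ m → 1 ≤ k → k ≤ 3 →
      1 ≤ (lit j k).1 ∧ (lit j k).1 ≤ n)
    {I : DLInterp CN RN ι} (hI : ∀ g ∈ Tqbf n m Qf lit, I.satG g) (k : ℕ) :
    ∀ (i : ℕ) (v : ℕ → Bool) (d : I.Dom), i + k = n → d ∈ I.iC (.L i) →
      (∀ l, 1 ≤ l → l ≤ i → d ∈ I.iC (.X l (v l))) →
      QVal Qf (SatPsi m lit) k (i + 1) v → d ∈ I.iC (.CT i) := by
  induction k with
  | zero =>
    rintro i v d rfl hL hX ⟨j, hj, hjm, hsat⟩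
    have hX' : ∀ k, 1 ≤ k → k ≤ 3 → d ∈ I.iC (.X (lit j k).1 (lit j k).2) := by
      intro k hk hk'
      obtain ⟨h1, h2⟩ := hlit j k hj hjm hk hk'
      exact hsat k hk hk' ▸ hX _ h1 h2
    have hA1 : d ∈ I.iC (.A1 j) :=
      hI ⟨.conj (.name (.L (i + 0))) (.name (.X (lit j 1).1 (lit j 1).2)), .name (.A1 j)⟩
        (.inr <| .inr <| .inr <| .inl ⟨j, hj, hjm, rfl⟩)
        ⟨hL, hX' 1 (by simp) (by simp)⟩
    have hA2 : d ∈ I.iC (.A2 j) :=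
      hI ⟨.conj (.name (.A1 j)) (.name (.X (lit j 2).1 (lit j 2).2)), .name (.A2 j)⟩
        (.inr <| .inr <| .inr <| .inr <| .inl ⟨j, hj, hjm, rfl⟩)
        ⟨hA1, hX' 2 (by simp) (by simp)⟩
    exact hI ⟨.conj (.name (.A2 j)) (.name (.X (lit j 3).1 (lit j 3).2)), .name (.CT (i + 0))⟩
        (.inr <| .inr <| .inr <| .inr <| .inr <| .inl ⟨j, hj, hjm, rfl⟩)
        ⟨hA2, hX' 3 (by simp) (by simp)⟩
  | succ k ih =>
    intro i v d hik hL hX hQ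
    have hi : i < n := by omega
    have hCTb : ∀ b, QVal Qf (SatPsi m lit) k (i + 1 + 1) (Function.update v (i + 1) b) →
        d ∈ I.iC (.CTb i b) := by
      intro b hb
      obtain ⟨e, hde, he⟩ :=
        hI ⟨.name (.L i), .ex (.pos (.r b (i + 1))) (.name (.L (i + 1)))⟩
          (.inl ⟨i, hi, b, rfl⟩) hL
      refine hI ⟨.ex (.pos (.r b (i + 1))) (.name (.CT (i + 1))), .name (.CTb i b)⟩
        (.inr <| .inr <| .inr <| .inr <| .inr <| .inr <| .inl ⟨i, hi, b, rfl⟩)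
        ⟨e, hde, ih (i + 1) _ e (by omega) he ?_ hb⟩
      intro l hl hli
      by_cases hl' : l = i + 1
      · subst hl'
        rw [Function.update_self]
        exact hI ⟨.ex (.inv (.r b (i + 1))) (.name (.L i)), .name (.X (i + 1) b)⟩
          (.inr <| .inl ⟨i, hi, b, rfl⟩) ⟨d, hde, hL⟩
      · rw [Function.update_of_ne hl']
        exact hI ⟨.ex (.inv (.r b (i + 1))) (.name (.X l (v l))), .name (.X l (v l))⟩
          (.inr <| .inr <| .inl
            ⟨l, hl, by omega, v l, b, i + 1, by omega, by omega, rfl⟩)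
          ⟨d, hde, hX l hl (by omega)⟩
    rw [QVal] at hQ
    split_ifs at hQ with hq
    · exact hI ⟨.conj (.name (.CTb i false)) (.name (.CTb i true)), .name (.CT i)⟩
        (.inr <| .inr <| .inr <| .inr <| .inr <| .inr <| .inr <| .inr ⟨i, hi, hq, rfl⟩)
        ⟨hCTb _ (hQ _), hCTb _ (hQ _)⟩
    · obtain ⟨b, hb⟩ := hQ
      exact hI ⟨.name (.CTb i b), .name (.CT i)⟩
        (.inr <| .inr <| .inr <| .inr <| .inr <| .inr <| .inr <| .inl
          ⟨i, hi, by simpa using hq, b, rfl⟩)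
        (hCTb b hb)

/-- The tree of partial assignments: a node `(i, v)` has decided `x₁, …, x_i` according to `v`,
and satisfies `C_i^True` iff the remaining formula is valid under `v`. -/
def assignmentTree (n m : ℕ) (Qf : ℕ → Bool) (lit : ℕ → ℕ → ℕ × Bool) :
    DLInterp CN RN ι where
  Dom := ℕ × (ℕ → Bool)
  inh := inferInstance
  iInd := fun _ => (0, fun _ => false)
  iC := fun
    | .L i => {p | p.1 = i}
    | .X l b => {p | l ≤ p.1 ∧ p.2 l = b}
    | .CT i => {p | p.1 = i ∧ QVal Qf (SatPsi m lit) (n - i) (i + 1) p.2}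
    | .CTb i b => {p | p.1 = i ∧
        QVal Qf (SatPsi m lit) (n - (i + 1)) (i + 1 + 1) (Function.update p.2 (i + 1) b)}
    | .A1 j => {p | p.1 = n ∧ p.2 (lit j 1).1 = (lit j 1).2}
    | .A2 j => {p | p.1 = n ∧ p.2 (lit j 1).1 = (lit j 1).2 ∧
        p.2 (lit j 2).1 = (lit j 2).2}
  iR := fun
    | .r d k => {e | e.1.1 + 1 = k ∧ e.2 = (k, Function.update e.1.2 k d)}

theorem assignmentTree_satG (n m : ℕ) (Qf : ℕ → Bool) (lit : ℕ → ℕ → ℕ × Bool) :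
    ∀ g ∈ Tqbf n m Qf lit, (assignmentTree n m Qf lit : DLInterp CN RN ι).satG g := by
  rintro g (⟨i, hi, d, rfl⟩ | ⟨i, hi, d, rfl⟩ | ⟨i, h1, hi, b, d, k, hk, hkn, rfl⟩ |
    ⟨j, hj, hjm, rfl⟩ | ⟨j, hj, hjm, rfl⟩ | ⟨j, hj, hjm, rfl⟩ | ⟨i, hi, d, rfl⟩ |
    ⟨i, hi, hq, d, rfl⟩ | ⟨i, hi, hq, rfl⟩)
  · rintro ⟨i', v⟩ (rfl : i' = i)
    exact ⟨(i' + 1, Function.update v (i' + 1) d), ⟨rfl, rfl⟩, rfl⟩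
  · rintro p ⟨⟨i', v⟩, ⟨-, hp⟩, -⟩
    obtain rfl : p = (i + 1, Function.update v (i + 1) d) := hp
    exact ⟨le_rfl, Function.update_self ..⟩
  · rintro p ⟨⟨i', v⟩, ⟨hik, hp⟩, hil, hv⟩
    obtain rfl : p = (k, Function.update v k d) := hp
    change i' + 1 = k at hik
    change i ≤ i' at hil
    exact ⟨by change i ≤ k; omega, (Function.update_of_ne (by omega) ..).trans hv⟩
  · rintro p ⟨hp, -, hv⟩
    exact ⟨hp, hv⟩
  · rintro p ⟨⟨hp, hv⟩, -, hv'⟩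
    exact ⟨hp, hv, hv'⟩
  · rintro p ⟨⟨hp, hv, hv'⟩, -, hv''⟩
    refine ⟨hp, ?_⟩
    rw [Nat.sub_self]
    refine ⟨j, hj, hjm, fun k hk hk' => ?_⟩
    interval_cases k <;> assumption
  · rintro ⟨i', v⟩ ⟨q, ⟨hi', hq⟩, -, hQ⟩
    obtain rfl : q = (i + 1, Function.update v (i + 1) d) := hq
    exact ⟨Nat.succ_injective hi', hQ⟩
  · rintro p ⟨hp, hQ⟩
    refine ⟨hp, ?_⟩
    rw [show n - i = n - (i + 1) + 1 by omega, QVal, if_neg (by simp [hq])]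
    exact ⟨d, hQ⟩
  · rintro p ⟨⟨hp, hQ₀⟩, -, hQ₁⟩
    refine ⟨hp, ?_⟩
    rw [show n - i = n - (i + 1) + 1 by omega, QVal, if_pos hq]
    exact Bool.forall_bool.2 ⟨hQ₀, hQ₁⟩

/-- Lemma 10/12 of the paper.  For a prenex 3-DNF QBF
`φ = Q₁x₁⋯Q_nx_n ψ` with `m` monomials whose literals mention only `x₁, …, x_n`,
the reduction KB `({L₀(a)}, T)` entails `C₀^True(a)` iff `φ` is valid. -/
theorem stmt9 (n m : ℕ) (Qf : ℕ → Bool) (lit : ℕ → ℕ → ℕ × Bool)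
    (hlit : ∀ j k, 1 ≤ j → j ≤ m → 1 ≤ k → k ≤ 3 →
      1 ≤ (lit j k).1 ∧ (lit j k).1 ≤ n) :
    DLEntails
      ({DLAssertion.conc (DLConcept.name (CN.L 0)) (0 : ℕ)} :
        Set (DLAssertion CN RN ℕ))
      (Tqbf n m Qf lit)
      (DLAssertion.conc (DLConcept.name (CN.CT 0)) 0) ↔
    QVal Qf (SatPsi m lit) n 1 (fun _ => false) := by
  constructor
  · intro h
    refine (h (assignmentTree n m Qf lit) ⟨?_, assignmentTree_satG n m Qf lit⟩).2
    rintro _ rfl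
    exact rfl
  · rintro hQ I ⟨hA, hT⟩
    exact mem_CT_of_QVal hlit hT n 0 _ _ (zero_add n) (hA _ rfl) (by omega) hQ
end

section
/- In the universal (canonical) model of the QBF-reduction KB (A,T) — a binary tree of depth n rooted at a, whose node at level i reached by following edges r_{σ₁,1},…,r_{σ_i,i} is identified with the string σ₁⋯σ_i ∈ {0,1}^i — the following holds for every 0 ≤ i ≤ n and every node σ₁⋯σ_i: the node satisfies C_i^True if and only if the partial assignment {x_j ↦ σ_j | 1 ≤ j ≤ i} satisfies Q_{i+1}x_{i+1}⋯Q_nx_n ψ. -/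
set_option autoImplicit false

variable {γ ρ ι : Type}

/-- The universal (canonical) model of the QBF-reduction KB `({L₀(a)}, T)`, obtained
by exhaustive rule application (the chase): its domain is the binary tree
`{0,1}^{≤ n}` (nodes as lists of booleans, the node reached from the root by the
edges `r_{σ₁,1}, …, r_{σ_i,i}` being the string `σ₁⋯σ_i`), the role `r_{d,i}`
connecting each node `σ` of length `i - 1` to its child `σ ++ [d]`; `Holds n m Qf
lit X σ` expresses that node `σ` satisfies the concept name `X`, defined as the
least fixpoint of the rules derived from the ABox `{L₀(a)}` and the TBox `Tqbf`. -/
inductive Holds (n m : ℕ) (Qf : ℕ → Bool) (lit : ℕ → ℕ → ℕ × Bool) :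
    CN → List Bool → Prop
  | root : Holds n m Qf lit (.L 0) []
  | lvl {i : ℕ} {σ : List Bool} {d : Bool} : i < n → σ.length = i →
      Holds n m Qf lit (.L i) σ → Holds n m Qf lit (.L (i + 1)) (σ ++ [d])
  | assign {i : ℕ} {σ : List Bool} {d : Bool} : i < n → σ.length = i →
      Holds n m Qf lit (.L i) σ → Holds n m Qf lit (.X (i + 1) d) (σ ++ [d])
  | prop {k : ℕ} {b : Bool} {σ : List Bool} {d : Bool} : σ.length < n →
      Holds n m Qf lit (.X k b) σ → Holds n m Qf lit (.X k b) (σ ++ [d])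
  | a1 {j : ℕ} {σ : List Bool} : 1 ≤ j → j ≤ m →
      Holds n m Qf lit (.L n) σ →
      Holds n m Qf lit (.X (lit j 1).1 (lit j 1).2) σ →
      Holds n m Qf lit (.A1 j) σ
  | a2 {j : ℕ} {σ : List Bool} : 1 ≤ j → j ≤ m →
      Holds n m Qf lit (.A1 j) σ →
      Holds n m Qf lit (.X (lit j 2).1 (lit j 2).2) σ →
      Holds n m Qf lit (.A2 j) σ
  | ctn {j : ℕ} {σ : List Bool} : 1 ≤ j → j ≤ m →
      Holds n m Qf lit (.A2 j) σ →
      Holds n m Qf lit (.X (lit j 3).1 (lit j 3).2) σ →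
      Holds n m Qf lit (.CT n) σ
  | ctb {i : ℕ} {σ : List Bool} {d : Bool} : i < n → σ.length = i →
      Holds n m Qf lit (.CT (i + 1)) (σ ++ [d]) →
      Holds n m Qf lit (.CTb i d) σ
  | ctE {i : ℕ} {σ : List Bool} {d : Bool} : i < n → Qf (i + 1) = false →
      Holds n m Qf lit (.CTb i d) σ → Holds n m Qf lit (.CT i) σ
  | ctA {i : ℕ} {σ : List Bool} : i < n → Qf (i + 1) = true →
      Holds n m Qf lit (.CTb i false) σ → Holds n m Qf lit (.CTb i true) σ →
      Holds n m Qf lit (.CT i) σ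

/-- The partial assignment encoded by a tree node: `x_k ↦ σ_k` for `1 ≤ k ≤ |σ|`
(and `false` outside that range). -/
def asg (σ : List Bool) (k : ℕ) : Bool := σ.getD (k - 1) false

theorem asg_append_of_le {σ : List Bool} {k : ℕ} (d : Bool) (hk : k ≤ σ.length)
    (hpos : 1 ≤ k) : asg (σ ++ [d]) k = asg σ k := by
  unfold asg
  rw [List.getD_append _ _ _ _ (by omega)]

theorem asg_append_length_succ (σ : List Bool) (d : Bool) :
    asg (σ ++ [d]) (σ.length + 1) = d := by
  simp [asg, List.getD_eq_getElem?_getD]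

/-- Away from the dummy index `0`, extending a node by `d` updates its assignment. -/
theorem asg_append_eq_update (σ : List Bool) (d : Bool) {k : ℕ} (hk : 1 ≤ k) :
    asg (σ ++ [d]) k = Function.update (asg σ) (σ.length + 1) d k := by
  rcases eq_or_ne k (σ.length + 1) with rfl | hne
  · rw [asg_append_length_succ, Function.update_self]
  rw [Function.update_of_ne hne]
  rcases le_or_gt k σ.length with hle | hgt
  · exact asg_append_of_le d hle hk
  · unfold asg
    rw [List.getD_eq_default _ _ (by simp; omega), List.getD_eq_default _ _ (by omega)]

theorem satPsi_congr {m : ℕ} {lit : ℕ → ℕ → ℕ × Bool}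
    (hlit : ∀ j k, 1 ≤ j → j ≤ m → 1 ≤ k → k ≤ 3 → 1 ≤ (lit j k).1)
    {v w : ℕ → Bool} (hvw : ∀ k, 1 ≤ k → v k = w k) :
    SatPsi m lit v ↔ SatPsi m lit w := by
  unfold SatPsi
  refine exists_congr fun j => and_congr_right fun h1 => and_congr_right fun h2 =>
    forall_congr' fun k => forall_congr' fun h3 => forall_congr' fun h4 => ?_
  rw [hvw _ (hlit j k h1 h2 h3 h4)]

theorem qVal_congr {Qf : ℕ → Bool} {Sat : (ℕ → Bool) → Prop}
    (hSat : ∀ v w : ℕ → Bool, (∀ k, 1 ≤ k → v k = w k) → (Sat v ↔ Sat w)) :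
    ∀ (l i : ℕ) (v w : ℕ → Bool), (∀ k, 1 ≤ k → v k = w k) →
      (QVal Qf Sat l i v ↔ QVal Qf Sat l i w)
  | 0, _, v, w, hvw => hSat v w hvw
  | l + 1, i, v, w, hvw => by
      have key : ∀ b, QVal Qf Sat l (i + 1) (Function.update v i b) ↔
          QVal Qf Sat l (i + 1) (Function.update w i b) := fun b =>
        qVal_congr hSat l (i + 1) _ _ fun k hk => by
          simp only [Function.update_apply, hvw k hk]
      simp only [QVal, key]

section Holds

variable {n m : ℕ} {Qf : ℕ → Bool} {lit : ℕ → ℕ → ℕ × Bool}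

theorem Holds.length_of_L {i : ℕ} {σ : List Bool} (h : Holds n m Qf lit (.L i) σ) :
    σ.length = i := by
  cases h with
  | root => rfl
  | lvl _ hlen _ => simp [hlen]

theorem Holds.asg_of_X {k : ℕ} {b : Bool} {σ : List Bool}
    (h : Holds n m Qf lit (.X k b) σ) : 1 ≤ k ∧ k ≤ σ.length ∧ asg σ k = b := by
  generalize hc : CN.X k b = c at h
  induction h <;> cases hc
  case assign i σ _ hlen _ _ =>
    subst hlen
    exact ⟨by omega, by simp, asg_append_length_succ _ _⟩
  case prop ih =>
    obtain ⟨h1, h2, h3⟩ := ih rfl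
    exact ⟨h1, by simp; omega, by rw [asg_append_of_le _ h2 h1, h3]⟩

theorem holds_L {σ : List Bool} (hσ : σ.length ≤ n) :
    Holds n m Qf lit (.L σ.length) σ := by
  induction σ using List.reverseRecOn with
  | nil => exact .root
  | append_singleton σ d ih =>
    rw [List.length_append, List.length_singleton] at hσ ⊢
    exact .lvl (by omega) rfl (ih (by omega))

theorem holds_X {σ : List Bool} (hσ : σ.length ≤ n) {k : ℕ} (hpos : 1 ≤ k)
    (hk : k ≤ σ.length) : Holds n m Qf lit (.X k (asg σ k)) σ := by
  induction σ using List.reverseRecOn with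
  | nil => simp at hk; omega
  | append_singleton σ d ih =>
    rw [List.length_append, List.length_singleton] at hσ hk
    rcases Nat.le_succ_iff.mp hk with hle | rfl
    · rw [asg_append_of_le d hle hpos]
      exact .prop (by omega) (ih (by omega) hle)
    · rw [asg_append_length_succ]
      exact .assign (by omega) rfl (holds_L (by omega))

/-- At a leaf, `C_n^True` says that the assignment satisfies the matrix. -/
theorem holds_CT_leaf_iff
    (hlit : ∀ j k, 1 ≤ j → j ≤ m → 1 ≤ k → k ≤ 3 →
      1 ≤ (lit j k).1 ∧ (lit j k).1 ≤ n)
    {σ : List Bool} (hσ : σ.length = n) :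
    Holds n m Qf lit (.CT n) σ ↔ SatPsi m lit (asg σ) := by
  constructor
  · intro h
    cases h with
    | ctE hlt _ _ => omega
    | ctA hlt _ _ _ => omega
    | ctn h1 hm hA2 hX3 =>
      cases hA2 with
      | a2 _ _ hA1 hX2 =>
        cases hA1 with
        | a1 _ _ _ hX1 =>
          refine ⟨_, h1, hm, fun k hk1 hk3 => ?_⟩
          interval_cases k
          · exact hX1.asg_of_X.2.2
          · exact hX2.asg_of_X.2.2
          · exact hX3.asg_of_X.2.2
  · rintro ⟨j, h1, hm, hsat⟩
    have hX : ∀ k, 1 ≤ k → k ≤ 3 →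
        Holds n m Qf lit (.X (lit j k).1 (lit j k).2) σ := fun k hk1 hk3 => by
      obtain ⟨hpos, hle⟩ := hlit j k h1 hm hk1 hk3
      rw [← hsat k hk1 hk3]
      exact holds_X hσ.le hpos (hle.trans hσ.ge)
    have hL : Holds n m Qf lit (.L n) σ := by
      simpa only [hσ] using holds_L (m := m) (Qf := Qf) (lit := lit) hσ.le
    exact .ctn h1 hm (.a2 h1 hm (.a1 h1 hm hL (hX 1 le_rfl (by omega)))
      (hX 2 (by omega) (by omega))) (hX 3 (by omega) le_rfl)

theorem holds_CTb_iff {σ : List Bool} {d : Bool} (hσ : σ.length < n) :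
    Holds n m Qf lit (.CTb σ.length d) σ ↔
      Holds n m Qf lit (.CT (σ.length + 1)) (σ ++ [d]) := by
  constructor
  · intro h
    cases h with
    | ctb _ _ h => exact h
  · exact .ctb hσ rfl

/-- At an inner node, `C_i^True` is the quantifier `Q_{i+1}` applied to the two children. -/
theorem holds_CT_inner_iff {σ : List Bool} (hσ : σ.length < n) :
    Holds n m Qf lit (.CT σ.length) σ ↔
      if Qf (σ.length + 1) = true then
        ∀ d, Holds n m Qf lit (.CT (σ.length + 1)) (σ ++ [d])
      else ∃ d, Holds n m Qf lit (.CT (σ.length + 1)) (σ ++ [d]) := by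
  simp only [← holds_CTb_iff hσ]
  constructor
  · intro h
    generalize hi : σ.length = i at h hσ ⊢
    cases h with
    | ctn _ _ hA2 _ =>
      cases hA2 with
      | a2 _ _ hA1 _ =>
        cases hA1 with
        | a1 _ _ hL _ => exact absurd hL.length_of_L (by omega)
    | ctE _ hQ h => rw [if_neg (by simp [hQ])]; exact ⟨_, h⟩
    | ctA _ hQ h0 h1 => rw [if_pos hQ]; exact fun d => by cases d <;> assumption
  · split_ifs with hQ
    · exact fun h => .ctA hσ hQ (h false) (h true)
    · rintro ⟨d, h⟩
      exact .ctE hσ (by simpa using hQ) h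

end Holds

/-- the claim inside Lemma 12 of the paper.  In the universal
model of the QBF-reduction KB, for every `0 ≤ i ≤ n` and every node `σ₁⋯σ_i` of the
binary tree: the node satisfies `C_i^True` iff the partial assignment
`{x_j ↦ σ_j | 1 ≤ j ≤ i}` satisfies `Q_{i+1}x_{i+1} ⋯ Q_n x_n ψ`. -/
theorem stmt10 (n m : ℕ) (Qf : ℕ → Bool) (lit : ℕ → ℕ → ℕ × Bool)
    (hlit : ∀ j k, 1 ≤ j → j ≤ m → 1 ≤ k → k ≤ 3 →
      1 ≤ (lit j k).1 ∧ (lit j k).1 ≤ n) :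
    ∀ i ≤ n, ∀ σ : List Bool, σ.length = i →
      (Holds n m Qf lit (CN.CT i) σ ↔
        QVal Qf (SatPsi m lit) (n - i) (i + 1) (asg σ)) := by
  have hSat : ∀ v w : ℕ → Bool, (∀ k, 1 ≤ k → v k = w k) →
      (SatPsi m lit v ↔ SatPsi m lit w) := fun _ _ =>
    satPsi_congr fun j k h1 h2 h3 h4 => (hlit j k h1 h2 h3 h4).1
  intro i hi
  induction hi using Nat.decreasingInduction with
  | self =>
    intro σ hσ
    rw [Nat.sub_self]
    exact holds_CT_leaf_iff hlit hσ
  | of_succ i hi ih =>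
    rintro σ rfl
    have hchild : ∀ d, Holds n m Qf lit (.CT (σ.length + 1)) (σ ++ [d]) ↔
        QVal Qf (SatPsi m lit) (n - (σ.length + 1)) (σ.length + 1 + 1)
          (Function.update (asg σ) (σ.length + 1) d) := fun d =>
      (ih (σ ++ [d]) (by simp)).trans
        (qVal_congr hSat _ _ _ _ fun _ hk => asg_append_eq_update σ d hk)
    obtain ⟨l, hl⟩ : ∃ l, n - σ.length = l + 1 := ⟨n - σ.length - 1, by omega⟩
    have hl' : n - (σ.length + 1) = l := by omega
    rw [holds_CT_inner_iff hi, hl, QVal]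
    simp only [hchild, hl']
end

section
/- In the universal (canonical) model of the QBF-reduction KB (A,T), for every 0 ≤ i ≤ n, every node σ₁⋯σ_i ∈ {0,1}^i of the binary tree, every 1 ≤ k ≤ n, and every b ∈ {0,1}: the node satisfies X_k^b if and only if k ≤ i and σ_k = b. In particular the concepts satisfied at σ₁⋯σ_i among the assignment concepts {X_k^0, X_k^1} are exactly X_1^{σ₁},…,X_i^{σ_i}. -/
set_option autoImplicit false

variable {γ ρ ι : Type}

theorem Holds.getElem?_of_X {n m : ℕ} {Qf : ℕ → Bool} {lit : ℕ → ℕ → ℕ × Bool} {k : ℕ}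
    {b : Bool} {σ : List Bool} (h : Holds n m Qf lit (.X k b) σ) : σ[k - 1]? = some b := by
  generalize hc : CN.X k b = c at h
  induction h with
  | assign _ hl _ _ =>
    cases hc
    simp [← hl]
  | prop _ _ ih =>
    cases hc
    obtain ⟨hlt, -⟩ := List.getElem?_eq_some_iff.mp (ih rfl)
    rw [List.getElem?_append_left hlt]
    exact ih rfl
  | _ => cases hc

theorem holds_L_length (n m : ℕ) (Qf : ℕ → Bool) (lit : ℕ → ℕ → ℕ × Bool) (σ : List Bool)
    (hσ : σ.length ≤ n) : Holds n m Qf lit (.L σ.length) σ := by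
  induction σ using List.reverseRecOn with
  | nil => exact .root
  | append_singleton σ d ih =>
    rw [List.length_append, List.length_singleton] at hσ ⊢
    exact .lvl hσ rfl (ih (Nat.le_of_succ_le hσ))

theorem holds_X_of_getElem? (n m : ℕ) (Qf : ℕ → Bool) (lit : ℕ → ℕ → ℕ × Bool) {k : ℕ}
    {b : Bool} {σ : List Bool} (hk : 1 ≤ k) (hσ : σ.length ≤ n) (h : σ[k - 1]? = some b) :
    Holds n m Qf lit (.X k b) σ := by
  induction σ using List.reverseRecOn with
  | nil => simp at h
  | append_singleton σ d ih =>
    rw [List.length_append, List.length_singleton] at hσ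
    by_cases hlt : k - 1 < σ.length
    · rw [List.getElem?_append_left hlt] at h
      exact .prop hσ (ih (Nat.le_of_succ_le hσ) h)
    · obtain ⟨hlen, -⟩ := List.getElem?_eq_some_iff.mp h
      rw [List.length_append, List.length_singleton] at hlen
      obtain rfl : k = σ.length + 1 := by omega
      obtain rfl : d = b := by simpa using h
      exact .assign hσ rfl (holds_L_length n m Qf lit σ (Nat.le_of_succ_le hσ))

/-- In the universal model of the QBF-reduction KB, for every
`0 ≤ i ≤ n`, every node `σ₁⋯σ_i ∈ {0,1}^i`, every `1 ≤ k ≤ n` and every `b`: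
the node satisfies `X_k^b` iff `k ≤ i` and `σ_k = b`.  In particular, among the
assignment concepts the node satisfies exactly `X_1^{σ₁}, …, X_i^{σ_i}`. -/
theorem stmt11 (n m : ℕ) (Qf : ℕ → Bool) (lit : ℕ → ℕ → ℕ × Bool)
    (hlit : ∀ j k, 1 ≤ j → j ≤ m → 1 ≤ k → k ≤ 3 →
      1 ≤ (lit j k).1 ∧ (lit j k).1 ≤ n) :
    ∀ i ≤ n, ∀ σ : List Bool, σ.length = i →
      ∀ (k : ℕ) (b : Bool), 1 ≤ k → k ≤ n →
        (Holds n m Qf lit (CN.X k b) σ ↔ (k ≤ i ∧ σ[k - 1]? = some b)) := by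
  rintro i hi σ rfl k b hk -
  refine ⟨fun h => ?_, fun h => holds_X_of_getElem? n m Qf lit hk hi h.2⟩
  have hb := h.getElem?_of_X
  obtain ⟨hlt, -⟩ := List.getElem?_eq_some_iff.mp hb
  exact ⟨by omega, hb⟩
end
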